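/- There is no even positive definite lattice of rank 6 with minimum ≥ 6 and determinant dividing 43. Consequently, an extremal even unimodular lattice of dimension 48 has no automorphism of order 43. -/

import Mathlib

open scoped RealInnerProductSpace

noncomputable section

abbrev Eu (n : ℕ) := EuclideanSpace ℝ (Fin n)

/-- The dual of a set of lattice vectors: all vectors pairing integrally with the set. -/
def dualSet {n : ℕ} (L : Set (Eu n)) : Set (Eu n) :=
  {x | ∀ y ∈ L, ∃ k : ℤ, ⟪x, y⟫ = (k : ℝ)}

/-- A set of vectors is even if all norms are even integers. -/
def IsEvenLat {n : ℕ} (L : Set (Eu n)) : Prop :=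
  ∀ x ∈ L, ∃ k : ℤ, ⟪x, x⟫ = 2 * (k : ℝ)

/-- σ is an automorphism of the lattice L: an orthogonal map preserving L. -/
def IsAutoOf {n : ℕ} (σ : Eu n ≃ₗ[ℝ] Eu n) (L : Submodule ℤ (Eu n)) : Prop :=
  (∀ x y : Eu n, ⟪σ x, σ y⟫ = ⟪x, y⟫) ∧ σ '' (L : Set (Eu n)) = (L : Set (Eu n))

/-- The fixed space ker(σ - 1). -/
def fixSpace {n : ℕ} (σ : Eu n ≃ₗ[ℝ] Eu n) : Submodule ℝ (Eu n) :=
  LinearMap.ker (σ.toLinearMap - LinearMap.id)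

/-- The image space im(σ - 1). -/
def imSpace {n : ℕ} (σ : Eu n ≃ₗ[ℝ] Eu n) : Submodule ℝ (Eu n) :=
  LinearMap.range (σ.toLinearMap - LinearMap.id)

/-- The intersection of a lattice with a rational subspace, as an additive subgroup. -/
def latIn {n : ℕ} (L : Submodule ℤ (Eu n)) (W : Submodule ℝ (Eu n)) : AddSubgroup (Eu n) :=
  L.toAddSubgroup ⊓ W.toAddSubgroup

/-- The dual lattice of a set S taken inside the subspace W. -/
def dualIn {n : ℕ} (W : Submodule ℝ (Eu n)) (S : Set (Eu n)) : AddSubgroup (Eu n) where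
  carrier := {x | x ∈ W ∧ ∀ y ∈ S, ∃ k : ℤ, ⟪x, y⟫ = (k : ℝ)}
  zero_mem' := ⟨W.zero_mem, fun y _ => ⟨0, by simp⟩⟩
  add_mem' := by
    rintro a b ⟨haW, ha⟩ ⟨hbW, hb⟩
    refine ⟨W.add_mem haW hbW, fun y hy => ?_⟩
    obtain ⟨k, hk⟩ := ha y hy
    obtain ⟨l, hl⟩ := hb y hy
    exact ⟨k + l, by rw [inner_add_left, hk, hl]; push_cast; ring⟩
  neg_mem' := by
    rintro a ⟨haW, ha⟩
    refine ⟨W.neg_mem haW, fun y hy => ?_⟩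
    obtain ⟨k, hk⟩ := ha y hy
    exact ⟨-k, by rw [inner_neg_left, hk]; push_cast; ring⟩

/-- An extremal even unimodular lattice of dimension 48: even, unimodular, full rank,
with minimum norm 6. -/
def IsExtremal48 (L : Submodule ℤ (Eu 48)) : Prop :=
  Submodule.span ℝ (L : Set (Eu 48)) = ⊤ ∧
  IsEvenLat (L : Set (Eu 48)) ∧
  dualSet (L : Set (Eu 48)) = (L : Set (Eu 48)) ∧
  (∀ x ∈ L, x ≠ 0 → 6 ≤ ⟪x, x⟫) ∧
  (∃ x ∈ L, ⟪x, x⟫ = (6 : ℝ))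

open MeasureTheory Module in
theorem det_gram_eq_sq {ι E : Type*} [Fintype ι] [DecidableEq ι] [NormedAddCommGroup E]
    [InnerProductSpace ℝ E] (e : OrthonormalBasis ι ℝ E) (b : ι → E) :
    (Matrix.of fun i j => ⟪b i, b j⟫).det = (e.toBasis.det b) ^ 2 := by
  have : (Matrix.of fun i j => ⟪b i, b j⟫) = (e.toBasis.toMatrix b).transpose * e.toBasis.toMatrix b := by
    ext i j
    simp [Matrix.mul_apply, Basis.toMatrix_apply, ← e.sum_inner_mul_inner (b i) (b j),
      OrthonormalBasis.repr_apply_apply, real_inner_comm]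
  rw [this, Matrix.det_mul, Matrix.det_transpose, Basis.det_apply, sq]

open MeasureTheory Module in
theorem exists_mem_span_inner_lt_six {E : Type*} [NormedAddCommGroup E] [InnerProductSpace ℝ E]
    [MeasurableSpace E] [BorelSpace E] (b : Basis (Fin 6) ℝ E)
    (hb : (Matrix.of fun i j => ⟪b i, b j⟫).det ≤ 43) :
    ∃ x ∈ Submodule.span ℤ (Set.range b), x ≠ 0 ∧ ⟪x, x⟫ < 6 := by
  have : FiniteDimensional ℝ E := b.finiteDimensional_of_finite
  have hE : finrank ℝ E = 2 * 3 := by simp [finrank_eq_card_basis b]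
  have : Nontrivial E := nontrivial_of_finrank_pos (R := ℝ) (by omega)
  let e : OrthonormalBasis (Fin 6) ℝ E := (stdOrthonormalBasis ℝ E).reindex (finCongr hE)
  have hdet : |e.toBasis.det b| < 7 := by
    rw [det_gram_eq_sq e] at hb
    exact abs_lt_of_sq_lt_sq (by linarith) (by norm_num)
  have he : volume (ZSpan.fundamentalDomain e.toBasis) = 1 := by
    rw [measure_congr (ZSpan.fundamentalDomain_ae_parallelepiped e.toBasis volume)]
    simpa using e.volume_parallelepiped
  have hvol : volume (ZSpan.fundamentalDomain b) * 2 ^ finrank ℝ E <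
      volume (Metric.ball (0 : E) √6) := by
    rw [ZSpan.measure_fundamentalDomain b volume e.toBasis, he,
      InnerProductSpace.volume_ball_of_dim_even hE, hE, mul_one,
      ← ENNReal.ofReal_pow (by positivity), ← ENNReal.ofReal_mul (by positivity),
      show (2 : ENNReal) = ENNReal.ofReal 2 by simp, ← ENNReal.ofReal_pow (by positivity),
      ← ENNReal.ofReal_mul (by positivity), ENNReal.ofReal_lt_ofReal_iff (by positivity),
      pow_mul √6, Real.sq_sqrt (by norm_num)]
    have hpi : (3 : ℝ) ^ 3 < Real.pi ^ 3 :=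
      pow_lt_pow_left₀ Real.pi_gt_three (by norm_num) (by norm_num)
    norm_num [Nat.factorial]
    linarith
  have : Countable (Submodule.span ℤ (Set.range b)).toAddSubgroup :=
    inferInstanceAs (Countable (Submodule.span ℤ (Set.range b)))
  obtain ⟨x, hx0, hx⟩ := exists_ne_zero_mem_lattice_of_measure_mul_two_pow_lt_measure
    (ZSpan.isAddFundamentalDomain' b volume) (by simp) (convex_ball 0 √6) hvol
  refine ⟨x, x.2, by simpa using hx0, ?_⟩
  rw [real_inner_self_eq_norm_sq]
  have := mem_ball_zero_iff.mp hx
  exact (Real.lt_sqrt (norm_nonneg _)).mp this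

open Polynomial in
theorem Matrix.charpoly_eq_of_irreducible_of_aeval_eq_zero {K n : Type*} [Field K] [Fintype n]
    [DecidableEq n] [Nonempty n] {A : Matrix n n K} {f : K[X]} (hf : Irreducible f)
    (hm : f.Monic) (hA : aeval A f = 0) (hn : Fintype.card n < 2 * f.natDegree) :
    A.charpoly = f := by
  have hmin : f = minpoly K A := minpoly.eq_of_irreducible_of_monic hf hA hm
  obtain ⟨g, hg⟩ : f ∣ A.charpoly := hmin ▸ A.minpoly_dvd_charpoly
  have hgm : g.Monic := hm.of_mul_monic_left (hg ▸ A.charpoly_monic)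
  have hdeg : f.natDegree + g.natDegree = Fintype.card n := by
    rw [← hm.natDegree_mul hgm, ← hg, A.charpoly_natDegree_eq_dim]
  suffices g.natDegree = 0 by
    rw [hg, hgm.natDegree_eq_zero.mp this, mul_one]
  by_contra h0
  obtain ⟨μ, hμ⟩ := IsAlgClosed.exists_aeval_eq_zero (AlgebraicClosure K) g
    (fun h => h0 (natDegree_eq_zero_iff_degree_le_zero.mpr h.le))
  have hroot : (A.map (algebraMap K (AlgebraicClosure K))).charpoly.IsRoot μ := by
    rw [Matrix.charpoly_map, IsRoot, eval_map_algebraMap, hg, map_mul, hμ, mul_zero]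
  rw [← Matrix.mem_spectrum_iff_isRoot_charpoly] at hroot
  have hfμ : aeval μ f = 0 := by
    have h1 := spectrum.subset_polynomial_aeval (A.map (algebraMap K (AlgebraicClosure K)))
      (f.map (algebraMap K (AlgebraicClosure K))) ⟨μ, hroot, rfl⟩
    have h2 : aeval (A.map (algebraMap K (AlgebraicClosure K)))
        (f.map (algebraMap K (AlgebraicClosure K))) = 0 := by
      rw [aeval_map_algebraMap]
      have := aeval_algHom_apply (Algebra.ofId K (AlgebraicClosure K)).mapMatrix A f
      rw [hA, map_zero] at this
      exact this
    rw [h2] at h1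
    simpa [eval_map_algebraMap] using h1
  have hd := natDegree_le_of_dvd (minpoly.dvd K μ hμ) hgm.ne_zero
  rw [← minpoly.eq_of_irreducible_of_monic hf hfμ hm] at hd
  omega

open Polynomial in
theorem Matrix.charpoly_eq_cyclotomic {n : Type*} [Fintype n] [DecidableEq n] [Nonempty n]
    {A : Matrix n n ℤ} {p : ℕ} (hp : p.Prime) (hA : aeval A (cyclotomic p ℤ) = 0)
    (hn : Fintype.card n < 2 * (p - 1)) : A.charpoly = cyclotomic p ℤ := by
  apply Polynomial.map_injective (Int.castRingHom ℚ) Int.cast_injective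
  rw [← Matrix.charpoly_map, map_cyclotomic]
  apply Matrix.charpoly_eq_of_irreducible_of_aeval_eq_zero (cyclotomic.irreducible_rat hp.pos)
    (cyclotomic.monic p ℚ)
  · have := aeval_algHom_apply (Int.castRingHom ℚ).toIntAlgHom.mapMatrix A (cyclotomic p ℤ)
    rw [hA, map_zero] at this
    rw [← map_cyclotomic p (algebraMap ℤ ℚ), aeval_map_algebraMap]
    exact this
  · rwa [natDegree_cyclotomic, Nat.totient_prime hp]

theorem Matrix.det_toBlocks₁₁_of_mul_eq_one {R κ μ : Type*} [CommRing R] [Fintype κ] [Fintype μ]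
    [DecidableEq κ] [DecidableEq μ] {U V : Matrix (κ ⊕ μ) (κ ⊕ μ) R} (h : U * V = 1) :
    U.toBlocks₁₁.det = U.det * V.toBlocks₂₂.det := by
  have hblock := h
  rw [← U.fromBlocks_toBlocks, ← V.fromBlocks_toBlocks, Matrix.fromBlocks_multiply,
    ← Matrix.fromBlocks_one, Matrix.fromBlocks_inj] at hblock
  obtain ⟨-, h12, -, h22⟩ := hblock
  have key : U * Matrix.fromBlocks 1 V.toBlocks₁₂ 0 V.toBlocks₂₂ =
      Matrix.fromBlocks U.toBlocks₁₁ 0 U.toBlocks₂₁ 1 := by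
    conv_lhs => rw [← U.fromBlocks_toBlocks]
    rw [Matrix.fromBlocks_multiply, h12, h22]
    simp
  have := congrArg Matrix.det key
  rw [Matrix.det_mul, Matrix.det_fromBlocks_zero₂₁, Matrix.det_fromBlocks_zero₁₂] at this
  simpa using this.symm

open Module in
theorem det_gram_dvd_det {M κ μ : Type*} [AddCommGroup M] [Fintype κ] [Fintype μ]
    [DecidableEq κ] [DecidableEq μ] (B : M →ₗ[ℤ] M →ₗ[ℤ] ℤ) (hB : ∀ x y, B x y = B y x)
    (c : Basis (κ ⊕ μ) ℤ M) (d : κ ⊕ μ → M)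
    (hd : ∀ i j, B (d i) (c j) = if i = j then 1 else 0) (T : M →ₗ[ℤ] M)
    (hT : ∀ i, T (c (Sum.inl i)) = 0) (hTperp : ∀ x i, B (T x) (c (Sum.inl i)) = 0)
    (hli : LinearIndependent ℤ fun j => T (c (Sum.inr j))) (R : Matrix μ μ ℤ)
    (hR : ∀ j, T (T (c (Sum.inr j))) = ∑ l, R l j • T (c (Sum.inr l))) :
    (Matrix.of fun i j => B (c (Sum.inl i)) (c (Sum.inl j))).det ∣ R.det := by
  have hc (x : M) : ∑ i, B x (d i) • c i = x := by
    conv_rhs => rw [← c.sum_repr x]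
    refine Finset.sum_congr rfl fun i _ => ?_
    have := congrArg (B (d i)) (c.sum_repr x)
    rw [hB, ← this]
    simp [hd, -Fintype.sum_sum_type, -Basis.sum_repr]
  have hdx (x : M) : ∑ i, B x (c i) • d i = x := by
    rw [← sub_eq_zero]
    have h0 : B (∑ i, B x (c i) • d i - x) = 0 := c.ext fun j => by simp [hd, -Fintype.sum_sum_type]
    rw [← hc (∑ i, B x (c i) • d i - x), h0]
    simp
  let U : Matrix (κ ⊕ μ) (κ ⊕ μ) ℤ := Matrix.of fun i j => B (c i) (c j)
  let V : Matrix (κ ⊕ μ) (κ ⊕ μ) ℤ := Matrix.of fun i j => B (d i) (d j)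
  have hUV : U * V = 1 := by
    ext i j
    have := congrArg (fun x => B x (d j)) (hdx (c i))
    simp only [map_sum, map_smul, LinearMap.sum_apply, LinearMap.smul_apply, smul_eq_mul] at this
    rw [Matrix.mul_apply, Matrix.one_apply]
    simp only [U, V, Matrix.of_apply]
    rw [this, hB, hd]
    simp only [eq_comm]
  have hU : IsUnit U.det := IsUnit.of_mul_eq_one V.det (by rw [← Matrix.det_mul, hUV, Matrix.det_one])
  have hG := Matrix.det_toBlocks₁₁_of_mul_eq_one hUV
  let A : Matrix μ μ ℤ := Matrix.of fun i j => B (T (c (Sum.inr j))) (c (Sum.inr i))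
  have hTd (i : μ) : T (d (Sum.inr i)) = ∑ l, V (Sum.inr i) (Sum.inr l) • T (c (Sum.inr l)) := by
    conv_lhs => rw [← hc (d (Sum.inr i))]
    simp [hT, V]
  have hRA : R = V.toBlocks₂₂.transpose * A := by
    ext l j
    have h1 : T (T (c (Sum.inr j))) =
        ∑ l, (V.toBlocks₂₂.transpose * A) l j • T (c (Sum.inr l)) := by
      conv_lhs => rw [← hdx (T (c (Sum.inr j)))]
      simp only [map_sum, map_smul, Fintype.sum_sum_type, hTperp, zero_smul,
        Finset.sum_const_zero, zero_add, hTd, Finset.smul_sum, Matrix.mul_apply, Finset.sum_smul,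
        Matrix.transpose_apply]
      rw [Finset.sum_comm]
      refine Finset.sum_congr rfl fun l _ => Finset.sum_congr rfl fun i _ => ?_
      rw [smul_smul, mul_comm]
      rfl
    rw [hR] at h1
    have h2 := Fintype.linearIndependent_iff.mp hli
      (fun l => R l j - (V.toBlocks₂₂.transpose * A) l j)
      (by simp only [sub_smul, Finset.sum_sub_distrib, h1, sub_self]) l
    exact sub_eq_zero.mp h2
  change U.toBlocks₁₁.det ∣ _
  rw [hG, hRA, Matrix.det_mul, Matrix.det_transpose, hU.mul_left_dvd]
  exact dvd_mul_right _ _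

open Module Polynomial in
theorem det_gram_ker_dvd_of_unimodular {M κ : Type*} [AddCommGroup M] [Module.Free ℤ M]
    [Module.Finite ℤ M] [Fintype κ] [DecidableEq κ] (B : M →ₗ[ℤ] M →ₗ[ℤ] ℤ)
    (hB : ∀ x y, B x y = B y x) (huni : ∀ f : M →ₗ[ℤ] ℤ, ∃ x, ∀ y, B x y = f y)
    {p : ℕ} (hp : p.Prime) (s : Module.End ℤ M) (hs : ∀ x y, B (s x) (s y) = B x y)
    (hsp : s ^ p = 1) (hs1 : s ≠ 1) (hrank : finrank ℤ M < 2 * (p - 1))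
    (b : Basis κ ℤ (LinearMap.ker (s - 1))) :
    Fintype.card κ + (p - 1) = finrank ℤ M ∧
      (Matrix.of fun i j => B (b i) (b j)).det ∣ (p : ℤ) := by
  obtain ⟨T, hTdef⟩ : ∃ T : Module.End ℤ M, T = s - 1 := ⟨_, rfl⟩
  revert b
  rw [← hTdef]
  intro b
  let bR := Free.chooseBasis ℤ (LinearMap.range T)
  let c := Basis.sumQuot b (bR.map T.quotKerEquivRange.symm)
  have hcl (i : κ) : c (Sum.inl i) = b i := Basis.sumQuot_inl _ _ i
  have hcr (j) : T (c (Sum.inr j)) = bR j := by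
    have h := Basis.sumQuot_inr b (bR.map T.quotKerEquivRange.symm) j
    rw [Basis.map_apply, LinearEquiv.eq_symm_apply] at h
    rw [← h]
    rfl
  have hcard := finrank_eq_card_basis c
  rw [Fintype.card_sum] at hcard
  have hne : Nonempty (Free.ChooseBasisIndex ℤ (LinearMap.range T)) := by
    by_contra h
    rw [not_nonempty_iff] at h
    have : Subsingleton (LinearMap.range T) := bR.repr.toEquiv.subsingleton
    rw [Submodule.subsingleton_iff_eq_bot, LinearMap.range_eq_bot, hTdef, sub_eq_zero] at this
    exact hs1 this
  let t : Module.End ℤ (LinearMap.range T) := T.restrict fun x _ => ⟨x, rfl⟩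
  have ht (i : ℕ) (x : LinearMap.range T) : (((t + 1) ^ i) x : M) = (s ^ i) x := by
    induction i generalizing x with
    | zero => simp
    | succ i ih =>
      rw [pow_succ, pow_succ, Module.End.mul_apply, ih, Module.End.mul_apply]
      simp [t, hTdef]
  let A := LinearMap.toMatrixAlgEquiv bR (t + 1)
  have hA : aeval A (cyclotomic p ℤ) = 0 := by
    have : aeval (t + 1) (cyclotomic p ℤ) = 0 := by
      have := Fact.mk hp
      rw [cyclotomic_prime]
      ext ⟨_, x, rfl⟩
      have h := LinearMap.congr_fun (geom_sum_mul s p) x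
      simp only [hsp, sub_self, LinearMap.zero_apply] at h
      rw [LinearMap.zero_apply, ZeroMemClass.coe_zero, ← h]
      simp [ht, LinearMap.sum_apply, hTdef]
    have h := aeval_algHom_apply (LinearMap.toMatrixAlgEquiv bR) (t + 1) (cyclotomic p ℤ)
    rw [this, map_zero] at h
    exact h
  have hchar := Matrix.charpoly_eq_cyclotomic hp hA (by omega)
  have hdeg := A.charpoly_natDegree_eq_dim
  rw [hchar, natDegree_cyclotomic, Nat.totient_prime hp] at hdeg
  refine ⟨by omega, ?_⟩
  have hdet : (LinearMap.toMatrixAlgEquiv bR t).det ∣ (p : ℤ) := by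
    have := Fact.mk hp
    have h1 := eval_one_cyclotomic_prime (R := ℤ) (p := p)
    rw [← hchar, Matrix.eval_charpoly] at h1
    have h2 : Matrix.scalar _ 1 - A = -LinearMap.toMatrixAlgEquiv bR t := by
      simp [A]
    rw [h2, Matrix.det_neg] at h1
    exact ⟨_, by rw [← h1, mul_comm]⟩
  choose d hd using fun i => huni (c.coord i)
  have key := det_gram_dvd_det B hB c d
    (fun i j => by rw [hd, Basis.coord_apply, Basis.repr_self, Finsupp.single_apply]; simp [eq_comm])
    T (fun i => by rw [hcl]; exact (b i).2)
    (fun x i => by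
      have hT (y : M) : T y = s y - y := by rw [hTdef]; rfl
      have h : s (b i) = b i := sub_eq_zero.mp ((hT _).symm.trans (b i).2)
      rw [hcl, hT, map_sub, LinearMap.sub_apply]
      nth_rw 1 [← h]
      rw [hs, sub_self])
    (by
      simp only [hcr]
      exact bR.linearIndependent.map' (LinearMap.range T).subtype (Submodule.ker_subtype _))
    (LinearMap.toMatrixAlgEquiv bR t)
    (fun j => by
      simp only [hcr]
      have h := congrArg Subtype.val (bR.sum_repr (t (bR j)))
      simp only [Submodule.coe_sum, Submodule.coe_smul] at h
      simp only [LinearMap.toMatrixAlgEquiv_apply]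
      exact h.symm)
  simp only [hcl] at key
  exact key.trans hdet

theorem linearIndependent_of_det_gram_ne_zero {ι E : Type*} [Fintype ι] [DecidableEq ι]
    [NormedAddCommGroup E] [InnerProductSpace ℝ E] {b : ι → E}
    (h : (Matrix.of fun i j => ⟪b i, b j⟫).det ≠ 0) : LinearIndependent ℝ b := by
  rw [Fintype.linearIndependent_iff]
  intro a ha
  refine fun i => congrFun (Matrix.eq_zero_of_mulVec_eq_zero h (v := a) ?_) i
  ext i
  have := congrArg (fun x => ⟪b i, x⟫) ha
  simp only [inner_sum, inner_smul_right, inner_zero_right] at this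
  simpa [Matrix.mulVec, dotProduct, mul_comm] using this

theorem exists_mem_span_range_inner_lt_six {E : Type*} [NormedAddCommGroup E]
    [InnerProductSpace ℝ E] [MeasurableSpace E] [BorelSpace E] {b : Fin 6 → E}
    (G : Matrix (Fin 6) (Fin 6) ℤ) (hG : ∀ i j, (G i j : ℝ) = ⟪b i, b j⟫) (hdvd : G.det ∣ 43) :
    ∃ x ∈ Submodule.span ℤ (Set.range b), x ≠ 0 ∧ ⟪x, x⟫ < 6 := by
  have hcast : (Matrix.of fun i j => ⟪b i, b j⟫).det = (G.det : ℝ) := by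
    rw [Int.cast_det]
    congr 1
    ext i j
    exact (hG i j).symm
  have h0 : (Matrix.of fun i j => ⟪b i, b j⟫).det ≠ 0 := by
    rw [hcast, Int.cast_ne_zero]
    exact ne_zero_of_dvd_ne_zero (by norm_num) hdvd
  have h : (Matrix.of fun i j => ⟪b i, b j⟫).det ≤ 43 := by
    rw [hcast]
    exact_mod_cast Int.le_of_dvd (by norm_num) hdvd
  let c := Module.Basis.span (linearIndependent_of_det_gram_ne_zero h0)
  have hc (i) : (c i : E) = b i := congrArg Subtype.val (Module.Basis.span_apply _ i)
  obtain ⟨x, hx, hx0, hx6⟩ := exists_mem_span_inner_lt_six c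
    (by simpa only [Submodule.coe_inner, hc] using h)
  refine ⟨x, ?_, by simpa using hx0, hx6⟩
  have := Submodule.mem_map_of_mem
    (f := (Submodule.span ℝ (Set.range b)).subtype.restrictScalars ℤ) hx
  rw [Submodule.map_span, ← Set.range_comp] at this
  have hcomp : (Submodule.span ℝ (Set.range b)).subtype.restrictScalars ℤ ∘ c = b := funext hc
  rwa [hcomp] at this

open Module in
theorem exists_mem_fixed_inner_lt_six {L : Submodule ℤ (Eu 48)} (hL : IsExtremal48 L)
    {σ : Eu 48 ≃ₗ[ℝ] Eu 48} (hσ : IsAutoOf σ L) (hord : orderOf σ = 43) :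
    ∃ x ∈ L, x ≠ 0 ∧ ⟪x, x⟫ < 6 := by
  obtain ⟨hspan, -, hdual, hmin, -⟩ := hL
  obtain ⟨hiso, himg⟩ := hσ
  have hdisc : DiscreteTopology L := DiscreteTopology.of_forall_le_norm one_pos fun x hx => by
    have h := hmin x x.2 (by simpa using hx)
    rw [real_inner_self_eq_norm_sq] at h
    have : 0 ≤ ‖(x : Eu 48)‖ := norm_nonneg _
    rw [Submodule.coe_norm]
    nlinarith
  have hlat : IsZLattice ℝ L := ⟨hspan⟩
  have hfin : Module.Finite ℤ L := ZLattice.module_finite ℝ L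
  have hfree : Module.Free ℤ L := ZLattice.module_free ℝ L
  have hrank : finrank ℤ L = 48 := by rw [ZLattice.rank ℝ L]; simp
  have hint (x y : L) : ∃ k : ℤ, ⟪(x : Eu 48), y⟫ = k := by
    have : (x : Eu 48) ∈ dualSet (L : Set (Eu 48)) := hdual.symm ▸ x.2
    exact this y y.2
  choose f hf using hint
  let B : L →ₗ[ℤ] L →ₗ[ℤ] ℤ := LinearMap.mk₂ ℤ f
    (fun x y z => by
      apply Int.cast_injective (α := ℝ)
      simp [← hf, inner_add_left])
    (fun k x z => by
      apply Int.cast_injective (α := ℝ)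
      simp [← hf, ← Int.cast_smul_eq_zsmul ℝ, inner_smul_left])
    (fun x y z => by
      apply Int.cast_injective (α := ℝ)
      simp [← hf, inner_add_right])
    (fun k x z => by
      apply Int.cast_injective (α := ℝ)
      simp [← hf, ← Int.cast_smul_eq_zsmul ℝ, inner_smul_right])
  have hB (x y : L) : ((B x y : ℤ) : ℝ) = ⟪(x : Eu 48), y⟫ := (hf x y).symm
  have huni (g : L →ₗ[ℤ] ℤ) : ∃ x, ∀ y, B x y = g y := by
    let c := (Free.chooseBasis ℤ L).ofZLatticeBasis ℝ L
    let φ : Eu 48 →ₗ[ℝ] ℝ := c.constr ℝ fun i => (g (Free.chooseBasis ℤ L i) : ℝ)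
    have hφ (y : L) : φ y = g y := by
      have : (φ.restrictScalars ℤ).comp L.subtype =
          (Int.castAddHom ℝ).toIntLinearMap.comp g := by
        refine (Free.chooseBasis ℤ L).ext fun i => ?_
        have := c.constr_basis ℝ (fun i => (g (Free.chooseBasis ℤ L i) : ℝ)) i
        rw [Basis.ofZLatticeBasis_apply] at this
        exact this
      exact LinearMap.congr_fun this y
    have hv (y : Eu 48) :
        ⟪(InnerProductSpace.toDual ℝ (Eu 48)).symm (LinearMap.toContinuousLinearMap φ), y⟫ = φ y := by
      rw [InnerProductSpace.toDual_symm_apply]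
      rfl
    have hvL : (InnerProductSpace.toDual ℝ (Eu 48)).symm (LinearMap.toContinuousLinearMap φ) ∈ L := by
      rw [← SetLike.mem_coe, ← hdual]
      exact fun y hy => ⟨g ⟨y, hy⟩, by rw [hv, ← hφ]⟩
    refine ⟨⟨_, hvL⟩, fun y => ?_⟩
    apply Int.cast_injective (α := ℝ)
    rw [hB, hv, hφ]
  let s : End ℤ L := (σ.toLinearMap.restrictScalars ℤ).restrict fun x hx => by
    rw [← SetLike.mem_coe, ← himg]
    exact ⟨x, hx, rfl⟩
  have hs_coe (x : L) : (s x : Eu 48) = σ x := rfl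
  have hs_pow (n : ℕ) (x : L) : ((s ^ n) x : Eu 48) = (σ ^ n) x := by
    induction n generalizing x with
    | zero => rfl
    | succ n ih => rw [pow_succ, pow_succ, Module.End.mul_apply, ih, LinearEquiv.mul_apply, hs_coe]
  have hsp : s ^ 43 = 1 := by
    ext x
    rw [hs_pow, ← hord, pow_orderOf_eq_one]
    rfl
  have hs1 : s ≠ 1 := by
    intro h
    have : σ.toLinearMap = LinearMap.id := LinearMap.ext_on hspan fun x hx => by
      have := congrArg Subtype.val (LinearMap.congr_fun h ⟨x, hx⟩)
      exact this
    have h1 : σ = 1 := LinearEquiv.toLinearMap_injective this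
    rw [h1, orderOf_one] at hord
    omega
  have hmain := fun b => det_gram_ker_dvd_of_unimodular (κ := Fin (finrank ℤ (LinearMap.ker (s - 1))))
    B (fun x y => by
      apply Int.cast_injective (α := ℝ)
      rw [hB, hB, real_inner_comm])
    huni (by norm_num : Nat.Prime 43) s
    (fun x y => by
      apply Int.cast_injective (α := ℝ)
      rw [hB, hB, hs_coe, hs_coe, hiso])
    hsp hs1 (by omega) b
  have hκ : finrank ℤ (LinearMap.ker (s - 1)) = 6 := by
    have := (hmain (finBasis ℤ _)).1
    rw [Fintype.card_fin] at this
    omega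
  rw [hκ] at hmain
  let b := finBasisOfFinrankEq ℤ (LinearMap.ker (s - 1)) hκ
  have hdvd := (hmain b).2
  obtain ⟨x, hx, hx0, hx6⟩ := exists_mem_span_range_inner_lt_six
    (b := fun i => ((b i : L) : Eu 48)) _ (fun i j => hB (b i) (b j)) hdvd
  refine ⟨x, ?_, hx0, hx6⟩
  exact Submodule.span_le.mpr (Set.range_subset_iff.mpr fun i => (b i : L).2) hx

/-- STATEMENT: There is no even positive definite lattice of rank 6 with minimum ≥ 6
and determinant dividing 43; consequently an extremal even unimodular lattice of
dimension 48 has no automorphism of order 43. -/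
theorem stmt6 :
    (¬ ∃ b : Fin 6 → Eu 6, LinearIndependent ℝ b ∧
      (∃ G : Matrix (Fin 6) (Fin 6) ℤ,
        (∀ i j, (G i j : ℝ) = ⟪b i, b j⟫) ∧ (∀ i, Even (G i i)) ∧  G.det ∣ 43) ∧
      (∀ x ∈ Submodule.span ℤ (Set.range b), x ≠ 0 → 6 ≤ ⟪x, x⟫)) ∧
    (∀ L : Submodule ℤ (Eu 48), IsExtremal48 L →
      ∀ σ : Eu 48 ≃ₗ[ℝ] Eu 48, IsAutoOf σ L → orderOf σ ≠ 43) := by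
  refine ⟨?_, fun L hL σ hσ hord => ?_⟩
  · rintro ⟨b, -, ⟨G, hG, -, hdvd⟩, hmin⟩
    obtain ⟨x, hx, hx0, hx6⟩ := exists_mem_span_range_inner_lt_six G hG hdvd
    exact absurd (hmin x hx hx0) (not_le.mpr hx6)
  · obtain ⟨x, hx, hx0, hx6⟩ := exists_mem_fixed_inner_lt_six hL hσ hord
    exact absurd (hL.2.2.2.1 x hx hx0) (not_le.mpr hx6)
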